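/- Let G be the join of graphs G_1 and G_2 with |V(G_1)| ≥ |V(G_2)| ≥ 1. Then G has a spanning tree with at most max(2, p − |V(G_2)| + 1) leaves, where p is the minimum path cover number of G_1. In particular, if p ≤ |V(G_2)| + 1 then G has a Hamiltonian path (a spanning tree with 2 leaves). -/

import Mathlib

open SimpleGraph

variable {V : Type*}

/-- `G` restricted to `s` has a path cover consisting of `p` vertex-disjoint paths
covering all of `s`. -/
def HasPathCover (G : SimpleGraph V) (s : Set V) (p : ℕ) : Prop :=
  ∃ P : Fin p → (u : V) × (v : V) × G.Walk u v,
    (∀ i, (P i).2.2.IsPath) ∧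
    (∀ i, ∀ x ∈ (P i).2.2.support, x ∈ s) ∧
    (∀ i j, i ≠ j → ∀ x, x ∈ (P i).2.2.support → x ∉ (P j).2.2.support) ∧
    (∀ x ∈ s, ∃ i, x ∈ (P i).2.2.support)

/-- A path cover of `s`, as a list of pairwise disjoint chains of vertices. -/
theorem HasPathCover.exists_list {G : SimpleGraph V} {s : Set V} {m : ℕ}
    (h : HasPathCover G s m) :
    ∃ L : List (List V), L.length = m ∧ (∀ c ∈ L, c ≠ [] ∧ c.IsChain G.Adj) ∧
      L.flatten.Nodup ∧ ∀ x, x ∈ L.flatten ↔ x ∈ s := by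
  obtain ⟨P, hpath, hsub, hdisj, hcov⟩ := h
  refine ⟨List.ofFn fun i => (P i).2.2.support, by simp, ?_, ?_, ?_⟩
  · intro c hc
    obtain ⟨i, rfl⟩ := (List.mem_ofFn' _ _).1 hc
    exact ⟨(P i).2.2.support_ne_nil, (P i).2.2.isChain_adj_support⟩
  · rw [List.nodup_flatten, List.pairwise_ofFn]
    refine ⟨fun c hc => ?_, fun i j hij x hi hj => hdisj i j hij.ne x hi hj⟩
    obtain ⟨i, rfl⟩ := (List.mem_ofFn' _ _).1 hc
    exact (hpath i).support_nodup
  · intro x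
    rw [List.mem_flatten]
    constructor
    · rintro ⟨c, hc, hx⟩
      obtain ⟨i, rfl⟩ := (List.mem_ofFn' _ _).1 hc
      exact hsub i x hx
    · intro hx
      obtain ⟨i, hi⟩ := hcov x hx
      exact ⟨_, (List.mem_ofFn' _ _).2 ⟨i, rfl⟩, hi⟩

theorem exists_hasPathCover [Finite V] (G : SimpleGraph V) (s : Set V) :
    ∃ m, HasPathCover G s m := by
  obtain ⟨n, ⟨e⟩⟩ := Finite.exists_equiv_fin s
  refine ⟨n, fun i => ⟨e.symm i, e.symm i, .nil⟩, fun i => .nil, ?_, ?_, ?_⟩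
  · simp
  · intro i j hij x hi hj
    simp only [Walk.support_nil, List.mem_singleton] at hi hj
    exact hij (e.symm.injective (Subtype.ext (hi.symm.trans hj)))
  · intro x hx
    exact ⟨e ⟨x, hx⟩, by simp⟩

/-- Chains can be cut so that their number is any value up to the number of vertices. -/
theorem List.exists_chains_of_length {α : Type*} {r : α → α → Prop} (k : ℕ)
    (L : List (List α)) (hL : ∀ c ∈ L, c ≠ [] ∧ c.IsChain r) (hk : L.length ≤ k)
    (hk' : k ≤ L.flatten.length) :
    ∃ L' : List (List α), L'.length = k ∧ (∀ c ∈ L', c ≠ [] ∧ c.IsChain r) ∧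
      L'.flatten = L.flatten := by
  induction k generalizing L with
  | zero => exact ⟨L, by omega, hL, rfl⟩
  | succ k ih =>
    match L with
    | [] => simp at hk'
    | [] :: L => exact absurd rfl (hL [] (by simp)).1
    | [a] :: L =>
      obtain ⟨L', h₁, h₂, h₃⟩ := ih L (fun c hc => hL c (by simp [hc])) (by simpa using hk)
        (by simp at hk' ⊢; omega)
      exact ⟨[a] :: L', by simp [h₁], by simpa using h₂, by simp [h₃]⟩
    | (a :: b :: c) :: L =>
      rcases Nat.lt_or_ge k (L.length + 1) with h | h
      · exact ⟨_, le_antisymm hk (by simpa using h), hL, rfl⟩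
      have hc := (hL (a :: b :: c) (by simp)).2
      obtain ⟨L', h₁, h₂, h₃⟩ := ih ((b :: c) :: L)
        (by
          intro d hd
          rcases List.mem_cons.1 hd with rfl | hd
          · exact ⟨by simp, hc.of_cons⟩
          · exact hL d (by simp [hd]))
        (by simpa using h) (by simp at hk' ⊢; omega)
      exact ⟨[a] :: L', by simp [h₁], by simpa using h₂, by simp [h₃]⟩

/-- Chains and separators that are related to all chain elements can be interleaved into a
single chain, which uses up every separator and one more chain than there are separators. -/
theorem List.exists_interleave {α : Type*} {r : α → α → Prop} (B : List α)
    (L : List (List α)) (hL : ∀ c ∈ L, c ≠ [] ∧ c.IsChain r)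
    (hr : ∀ b ∈ B, ∀ x ∈ L.flatten, r b x ∧ r x b) (hlen : B.length ≤ L.length) :
    ∃ (l : List α) (R : List (List α)), l.IsChain r ∧ R ⊆ L ∧
      R.length = L.length - B.length - 1 ∧ (∀ x ∈ l.head?, x ∈ L.flatten) ∧ B ⊆ l ∧
      (l ++ R.flatten).Perm (B ++ L.flatten) := by
  induction B generalizing L with
  | nil =>
    match L with
    | [] => exact ⟨[], [], by simp⟩
    | c :: L =>
      refine ⟨c, L, (hL c (by simp)).2, by simp, by simp, fun x hx => ?_, by simp, by simp⟩
      simp [List.mem_of_mem_head? hx]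
  | cons b B ih =>
    match L with
    | [] => simp at hlen
    | c :: L =>
      obtain ⟨l, R, hl, hRL, hRlen, hhead, hBl, hperm⟩ := ih L
        (fun d hd => hL d (by simp [hd]))
        (fun b' hb' x hx => hr b' (by simp [hb']) x (by
          rw [List.flatten_cons]; exact List.mem_append_right _ hx))
        (by simpa using hlen)
      obtain ⟨hc, hcc⟩ := hL c (by simp)
      refine ⟨c ++ b :: l, R, hcc.append ?_ ?_, fun d hd => List.mem_cons_of_mem _ (hRL hd),
        by simp [hRlen], ?_, ?_, ?_⟩
      · refine List.isChain_cons.2 ⟨fun y hy => ?_, hl⟩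
        refine (hr b (by simp) y ?_).1
        rw [List.flatten_cons]
        exact List.mem_append_right _ (hhead y hy)
      · intro x hx y hy
        obtain rfl : b = y := by simpa using hy
        refine (hr b (by simp) x ?_).2
        rw [List.flatten_cons]
        exact List.mem_append_left _ (List.mem_of_mem_getLast? hx)
      · intro x hx
        rw [List.head?_append_of_ne_nil _ hc] at hx
        rw [List.flatten_cons]
        exact List.mem_append_left _ (List.mem_of_mem_head? hx)
      · intro x hx
        rcases List.mem_cons.1 hx with rfl | hx
        · simp
        · simp [hBl hx]
      · have h₁ := (hperm.cons b).append_left c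
        have h₂ := (List.perm_append_comm (l₁ := c) (l₂ := b :: B)).append_right L.flatten
        simpa using h₁.trans (by simpa using h₂)

/-- `T` is a subtree of `G` on the vertex set `S`, and every vertex of `S` outside `F` has at
least two neighbours in `T`. -/
structure IsSubtreeOn (G : SimpleGraph V) (S F : Finset V) (T : SimpleGraph V) : Prop where
  le : T ≤ G
  acyclic : T.IsAcyclic
  mem_of_adj : ∀ u v, T.Adj u v → u ∈ S
  reachable : ∀ u ∈ S, ∀ v ∈ S, T.Reachable u v
  two_neighbors : ∀ u ∈ S, u ∉ F → ∃ a b, a ≠ b ∧ T.Adj u a ∧ T.Adj u b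

namespace IsSubtreeOn

variable [DecidableEq V] {G T : SimpleGraph V} {S F : Finset V} {u v w : V}

theorem singleton (G : SimpleGraph V) (a : V) : IsSubtreeOn G {a} {a} ⊥ where
  le := bot_le
  acyclic := isAcyclic_bot
  mem_of_adj := by simp
  reachable := by simp
  two_neighbors := by simp

theorem sup_edge (h : IsSubtreeOn G S F T) (hu : u ∈ S) (hv : v ∉ S) (huv : G.Adj u v)
    {F' : Finset V} (hvF : v ∈ F')
    (hF : ∀ x ∈ S, x ∉ F' → x ∈ F → x = u ∧ ∃ w, T.Adj u w) :
    IsSubtreeOn G (insert v S) F' (T ⊔ edge u v) where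
  le := sup_le h.le ((edge_le_iff _).2 (.inr huv))
  acyclic := by
    refine h.acyclic.sup_edge_of_not_reachable fun hr => ?_
    obtain ⟨w⟩ := hr.symm
    cases w with
    | nil => exact hv hu
    | cons hadj _ => exact hv (h.mem_of_adj _ _ hadj)
  mem_of_adj := by
    intro x y hxy
    rcases hxy with hxy | hxy
    · exact Finset.mem_insert_of_mem (h.mem_of_adj _ _ hxy)
    · rcases ((edge_adj _ _ _ _).1 hxy).1 with ⟨rfl, -⟩ | ⟨rfl, -⟩ <;> simp [hu]
  reachable := by
    have hadj : (T ⊔ edge u v).Adj u v := .inr ((edge_adj _ _ _ _).2 ⟨.inl ⟨rfl, rfl⟩, huv.ne⟩)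
    have key : ∀ x ∈ insert v S, (T ⊔ edge u v).Reachable u x := by
      intro x hx
      rcases Finset.mem_insert.1 hx with rfl | hx
      · exact hadj.reachable
      · exact (h.reachable u hu x hx).mono le_sup_left
    exact fun x hx y hy => (key x hx).symm.trans (key y hy)
  two_neighbors := by
    intro x hx hxF'
    rcases Finset.mem_insert.1 hx with rfl | hx
    · exact absurd hvF hxF'
    by_cases hxF : x ∈ F
    · obtain ⟨rfl, w, hw⟩ := hF x hx hxF' hxF
      refine ⟨w, v, ?_, .inl hw, .inr ((edge_adj _ _ _ _).2 ⟨.inl ⟨rfl, rfl⟩, huv.ne⟩)⟩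
      rintro rfl
      exact hv (h.mem_of_adj _ _ hw.symm)
    · obtain ⟨a, b, hab, ha, hb⟩ := h.two_neighbors x hx hxF
      exact ⟨a, b, hab, .inl ha, .inl hb⟩

/-- Extending a subtree by a path that starts at a leaf does not create new leaves. -/
theorem exists_extend_leaf (c : List V) (h : IsSubtreeOn G S F T) (hv : v ∈ S) (hvF : v ∈ F)
    (hvw : T.Adj v w) (hc : (v :: c).IsChain G.Adj) (hnd : c.Nodup) (hdisj : ∀ x ∈ c, x ∉ S) :
    ∃ F' T', F'.card ≤ F.card ∧ IsSubtreeOn G (S ∪ c.toFinset) F' T' := by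
  induction c generalizing S F T v w with
  | nil => exact ⟨F, T, le_rfl, by simpa using h⟩
  | cons x c ih =>
    obtain ⟨hvx, hc⟩ := List.isChain_cons_cons.1 hc
    obtain ⟨hxc, hnd⟩ := List.nodup_cons.1 hnd
    have hxS := hdisj x (by simp)
    have h' := h.sup_edge (F' := insert x (F.erase v)) hv hxS hvx (by simp) (by
      intro y _ hy hyF
      have : y = v := by
        by_contra hne
        exact hy (by simp [hne, hyF])
      exact ⟨this, w, hvw⟩)
    obtain ⟨F', T', hF', hT'⟩ := ih (v := x) (w := v) h' (by simp) (by simp)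
      (.inr ((edge_adj _ _ _ _).2 ⟨.inr ⟨rfl, rfl⟩, hvx.ne'⟩)) hc hnd (by
        intro y hy hyS
        rcases Finset.mem_insert.1 hyS with rfl | hyS
        · exact hxc hy
        · exact hdisj y (by simp [hy]) hyS)
    refine ⟨F', T', hF'.trans ((Finset.card_insert_le _ _).trans ?_), ?_⟩
    · rw [Finset.card_erase_add_one hvF]
    · convert hT' using 1
      ext; simp

/-- Attaching a path to a subtree creates at most one new leaf. -/
theorem exists_extend (c : List V) (h : IsSubtreeOn G S F T) (hu : u ∈ S)
    (hc : (u :: c).IsChain G.Adj) (hnd : c.Nodup) (hdisj : ∀ x ∈ c, x ∉ S) :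
    ∃ F' T', F'.card ≤ F.card + 1 ∧ IsSubtreeOn G (S ∪ c.toFinset) F' T' := by
  match c with
  | [] => exact ⟨F, T, by omega, by simpa using h⟩
  | x :: c =>
    obtain ⟨hux, hc⟩ := List.isChain_cons_cons.1 hc
    obtain ⟨hxc, hnd⟩ := List.nodup_cons.1 hnd
    have h' := h.sup_edge (F' := insert x F) hu (hdisj x (by simp)) hux (by simp)
      (fun y _ hy hyF => absurd (Finset.mem_insert_of_mem hyF) hy)
    obtain ⟨F', T', hF', hT'⟩ := h'.exists_extend_leaf c (v := x) (w := u) (by simp) (by simp)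
      (.inr ((edge_adj _ _ _ _).2 ⟨.inr ⟨rfl, rfl⟩, hux.ne'⟩)) hc hnd (by
        intro y hy hyS
        rcases Finset.mem_insert.1 hyS with rfl | hyS
        · exact hxc hy
        · exact hdisj y (by simp [hy]) hyS)
    refine ⟨F', T', hF'.trans (Finset.card_insert_le _ _), ?_⟩
    convert hT' using 1
    ext; simp

theorem exists_extend_flatten (R : List (List V)) (h : IsSubtreeOn G S F T) (hu : u ∈ S)
    (hR : ∀ c ∈ R, (u :: c).IsChain G.Adj) (hnd : R.flatten.Nodup)
    (hdisj : ∀ x ∈ R.flatten, x ∉ S) :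
    ∃ F' T', F'.card ≤ F.card + R.length ∧ IsSubtreeOn G (S ∪ R.flatten.toFinset) F' T' := by
  induction R generalizing S F T with
  | nil => exact ⟨F, T, le_rfl, by simpa using h⟩
  | cons c R ih =>
    rw [List.flatten_cons] at hnd hdisj
    obtain ⟨hndc, hndR, hcR⟩ := List.nodup_append'.1 hnd
    obtain ⟨F₁, T₁, hF₁, hT₁⟩ := h.exists_extend c hu (hR c (by simp)) hndc
      (fun x hx => hdisj x (List.mem_append_left _ hx))
    obtain ⟨F₂, T₂, hF₂, hT₂⟩ := ih hT₁ (Finset.mem_union_left _ hu)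
      (fun d hd => hR d (by simp [hd])) hndR (by
        intro x hx hxS
        rcases Finset.mem_union.1 hxS with hxS | hxc
        · exact hdisj x (List.mem_append_right _ hx) hxS
        · exact hcR (List.mem_toFinset.1 hxc) hx)
    refine ⟨F₂, T₂, by simp; omega, ?_⟩
    convert hT₂ using 1
    rw [List.flatten_cons, List.toFinset_append, Finset.union_assoc]

theorem ncard_leaves_le [Fintype V] (h : IsSubtreeOn G Finset.univ F T) :
    {v : V | {u : V | T.Adj v u}.ncard = 1}.ncard ≤ F.card := by
  rw [← Set.ncard_coe_finset]
  refine Set.ncard_le_ncard (fun v hv => ?_) F.finite_toSet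
  by_contra hvF
  obtain ⟨a, b, hab, ha, hb⟩ := h.two_neighbors v (Finset.mem_univ v) hvF
  obtain ⟨x, hx⟩ := Set.ncard_eq_one.1 hv
  have ha' : a ∈ ({x} : Set V) := hx ▸ ha
  have hb' : b ∈ ({x} : Set V) := hx ▸ hb
  exact hab (ha'.trans hb'.symm)

end IsSubtreeOn

/-- In a join, all vertices can be listed as one chain containing the second part together with
`p - |V(G_2)| - 1` chains of the first part. -/
theorem exists_chain_and_chains [Fintype V] (G : SimpleGraph V) (f : V → Bool)
    (hjoin : ∀ u v : V, f u ≠ f v → G.Adj u v)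
    (hcard : Fintype.card {v // f v = false} ≤ Fintype.card {v // f v = true})
    {p : ℕ} (hp : HasPathCover G {v | f v = true} p) :
    ∃ (l : List V) (R : List (List V)), l.IsChain G.Adj ∧
      R.length = p - Fintype.card {v // f v = false} - 1 ∧
      (∀ c ∈ R, c.IsChain G.Adj ∧ ∀ x ∈ c, f x = true) ∧ (∀ v, f v = false → v ∈ l) ∧
      (l ++ R.flatten).Nodup ∧ ∀ v, v ∈ l ++ R.flatten := by
  obtain ⟨L, hLlen, hL, hLnd, hLmem⟩ := hp.exists_list
  have hLcard : L.flatten.length = Fintype.card {v // f v = true} := by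
    classical
    rw [Fintype.card_subtype, ← List.toFinset_card_of_nodup hLnd]
    congr 1
    ext x
    simpa using hLmem x
  have hLle : L.length ≤ L.flatten.length := by
    rw [List.length_flatten]
    refine (List.length_map List.length (as := L)).symm.le.trans
      (List.length_le_sum_of_one_le _ ?_)
    intro n hn
    obtain ⟨c, hc, rfl⟩ := List.mem_map.1 hn
    exact List.length_pos_iff.2 (hL c hc).1
  let B : List V := (Finset.univ.filter fun v => f v = false).toList
  have hB : ∀ v, v ∈ B ↔ f v = false := by simp [B]
  have hBlen : B.length = Fintype.card {v // f v = false} := by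
    rw [Finset.length_toList, Fintype.card_subtype]
  obtain ⟨L', hlen', hL', hflat⟩ := List.exists_chains_of_length (max p B.length) L hL
    (by omega) (by omega)
  obtain ⟨l, R, hl, hRL, hRlen, -, hBl, hperm⟩ := List.exists_interleave (r := G.Adj) B L' hL'
    (by
      intro b hb x hx
      rw [hflat, hLmem] at hx
      have : G.Adj b x := hjoin b x (by rw [(hB b).1 hb, hx]; decide)
      exact ⟨this, this.symm⟩) (by omega)
  rw [hflat] at hperm
  refine ⟨l, R, hl, by omega, fun c hc => ⟨(hL' c (hRL hc)).2, fun x hx => ?_⟩,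
    fun v hv => hBl ((hB v).2 hv), hperm.nodup_iff.2 ?_, fun v => hperm.mem_iff.2 ?_⟩
  · exact (hLmem x).1 (hflat ▸ List.mem_flatten.2 ⟨c, hRL hc, hx⟩)
  · refine (Finset.nodup_toList _).append hLnd fun x hxB hxL => ?_
    have h₁ := (hB x).1 hxB
    have h₂ : f x = true := (hLmem x).1 hxL
    simp [h₁] at h₂
  · cases hv : f v
    · exact List.mem_append_left _ ((hB v).2 hv)
    · exact List.mem_append_right _ ((hLmem v).2 hv)

/-- Let `G` be the join of `G_1` and `G_2` (the fibers of `f`) with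
`|V(G_1)| ≥ |V(G_2)| ≥ 1`, and let `p` be the minimum path cover number of `G_1`. Then
`G` has a spanning tree with at most `max 2 (p - |V(G_2)| + 1)` leaves; in particular, if
`p ≤ |V(G_2)| + 1` then `G` has a Hamiltonian path. -/
theorem stmt_19 [Fintype V] [DecidableEq V] (G : SimpleGraph V) (f : V → Bool)
    (hjoin : ∀ u v : V, f u ≠ f v → G.Adj u v)
    (h2ne : ∃ v, f v = false)
    (hcard : Fintype.card {v // f v = false} ≤ Fintype.card {v // f v = true})
    (p : ℕ) (hp : p = sInf {m : ℕ | HasPathCover G {v | f v = true} m}) :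
    (∃ T : SimpleGraph V, T ≤ G ∧ T.IsTree ∧
        ({v : V | ({u : V | T.Adj v u}).ncard = 1}).ncard ≤
          max 2 (p - Fintype.card {v // f v = false} + 1)) ∧
    (p ≤ Fintype.card {v // f v = false} + 1 →
        ∃ a b : V, ∃ w : G.Walk a b, w.IsHamiltonian) := by
  obtain ⟨b, hb⟩ := h2ne
  have hcover : HasPathCover G {v | f v = true} p :=
    hp ▸ Nat.sInf_mem (exists_hasPathCover G {v | f v = true})
  obtain ⟨l, R, hl, hRlen, hR, hfl, hnd, hmem⟩ := exists_chain_and_chains G f hjoin hcard hcover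
  have hbl := hfl b hb
  obtain ⟨hndl, hndR, hlR⟩ := List.nodup_append'.1 hnd
  constructor
  · obtain ⟨a, l, rfl⟩ := List.exists_cons_of_ne_nil (List.ne_nil_of_mem hbl)
    obtain ⟨hal, hndl⟩ := List.nodup_cons.1 hndl
    obtain ⟨F₁, T₁, hF₁, hT₁⟩ := (IsSubtreeOn.singleton G a).exists_extend l (by simp) hl hndl
      (by
        intro x hx hxa
        rw [Finset.mem_singleton] at hxa
        exact hal (hxa ▸ hx))
    obtain ⟨F₂, T₂, hF₂, hT₂⟩ := hT₁.exists_extend_flatten R (u := b) (by simpa using hbl)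
      (fun c hc => List.isChain_cons.2 ⟨fun y hy => hjoin b y (by
        rw [hb, (hR c hc).2 y (List.mem_of_mem_head? hy)]; decide), (hR c hc).1⟩) hndR
      (fun x hx hxl => hlR (by simpa using hxl) hx)
    have huniv : ({a} ∪ l.toFinset) ∪ R.flatten.toFinset = Finset.univ := by
      ext x
      simpa [or_assoc] using hmem x
    rw [huniv] at hT₂
    have : Nonempty V := ⟨a⟩
    refine ⟨T₂, hT₂.le, ⟨⟨fun u v => hT₂.reachable u (by simp) v (by simp)⟩, hT₂.acyclic⟩,
      hT₂.ncard_leaves_le.trans (hF₂.trans ?_)⟩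
    rw [Finset.card_singleton] at hF₁
    omega
  · intro hle
    obtain rfl : R = [] := List.eq_nil_of_length_eq_zero (by omega)
    refine ⟨_, _, Walk.ofSupport l (List.ne_nil_of_mem hbl) hl, fun v => ?_⟩
    rw [Walk.support_ofSupport]
    exact List.count_eq_one_of_mem hndl (by simpa using hmem v)
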